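/- For every real q with 0 < q < 1, one has R(q) = (√(x² + 2x + 5) − x − 1)/2, where x = f(−q^{1/5})/(q^{1/5} f(−q⁵)) = q^{−1/5} ∏_{n=1}^∞ (1 − q^{n/5}) / ∏_{n=1}^∞ (1 − q^{5n}), R(q) = q^{1/5} ∏_{n=1}^∞ (1 − qⁿ)^{χ₅(n)}, and f(−q) = ∏_{n=1}^∞ (1 − qⁿ). -/

import Mathlib

/-- The Legendre symbol modulo 5 as an integer-valued function. -/
def chi5 (n : ℕ) : ℤ :=
  if n % 5 = 1 ∨ n % 5 = 4 then 1
  else if n % 5 = 2 ∨ n % 5 = 3 then -1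
  else 0

/-- The Rogers–Ramanujan continued fraction, given by its product representation
`R(q) = q^{1/5} ∏_{n=1}^∞ (1 - q^n)^{χ₅(n)}`. -/
noncomputable def RR (q : ℝ) : ℝ :=
  q ^ ((1 : ℝ) / 5) * ∏' n : ℕ, (1 - q ^ (n + 1)) ^ chi5 (n + 1)

open Filter Topology

lemma summable_pow_sq_mul_zpow {p z : ℝ} (hp0 : 0 < p) (hp1 : p < 1) (hz : 0 < z) :
    Summable fun n : ℤ ↦ p ^ (n ^ 2) * z ^ n := by
  have key : ∀ w : ℝ, 0 < w → Summable fun n : ℕ ↦ p ^ (n ^ 2) * w ^ n := by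
    intro w hw
    have hlim : Tendsto (fun n : ℕ ↦ p ^ n * w) atTop (𝓝 0) := by
      simpa using (tendsto_pow_atTop_nhds_zero_of_lt_one hp0.le hp1).mul_const w
    refine summable_of_isBigO_nat summable_geometric_two (Asymptotics.IsBigO.of_bound 1 ?_)
    filter_upwards [hlim.eventually_le_const (show (0 : ℝ) < 1 / 2 by norm_num)] with n hn
    have h0 : 0 ≤ p ^ n * w := by positivity
    have : p ^ (n ^ 2) * w ^ n = (p ^ n * w) ^ n := by ring
    rw [this, one_mul, norm_pow, norm_pow, Real.norm_of_nonneg h0,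
      Real.norm_of_nonneg (by norm_num : (0 : ℝ) ≤ 1 / 2)]
    gcongr
  refine Summable.of_nat_of_neg ((key z hz).congr fun n ↦ ?_)
    ((key z⁻¹ (inv_pos.2 hz)).congr fun n ↦ ?_)
  · norm_cast
  · rw [neg_sq, zpow_neg, ← inv_zpow]
    norm_cast

lemma multipliable_one_sub_mul_pow (c : ℝ) {r : ℝ} (hr0 : 0 ≤ r) (hr1 : r < 1) :
    Multipliable fun k : ℕ ↦ 1 - c * r ^ k := by
  simp_rw [sub_eq_add_neg]
  exact Real.multipliable_one_add_of_summable
    ((summable_geometric_of_lt_one hr0 hr1).mul_left c).neg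

lemma tprod_one_sub_mul_pow_pos {c r : ℝ} (hc0 : 0 ≤ c) (hc1 : c < 1) (hr0 : 0 ≤ r)
    (hr1 : r < 1) : 0 < ∏' k : ℕ, (1 - c * r ^ k) := by
  have h (k : ℕ) : 0 < 1 - c * r ^ k :=
    sub_pos.2 ((mul_le_of_le_one_right hc0 (pow_le_one₀ hr0 hr1.le)).trans_lt hc1)
  refine lt_of_le_of_ne' (ge_of_tendsto'
    (multipliable_one_sub_mul_pow c hr0 hr1).tendsto_prod_tprod_nat
    fun n ↦ Finset.prod_nonneg fun k _ ↦ (h k).le) ?_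
  simp_rw [sub_eq_add_neg] at h ⊢
  exact tprod_one_add_ne_zero_of_summable (fun k ↦ (h k).ne')
    ((summable_geometric_of_lt_one hr0 hr1).mul_left c).neg.norm

/-- The finite `q`-Pochhammer symbol `(P; P)ₙ`. -/
noncomputable def qFactorial (P : ℝ) (n : ℕ) : ℝ := ∏ k ∈ Finset.range n, (1 - P * P ^ k)

lemma qFactorial_pos {P : ℝ} (hP0 : 0 < P) (hP1 : P < 1) (n : ℕ) : 0 < qFactorial P n :=
  Finset.prod_pos fun k _ ↦ by
    rw [← pow_succ', sub_pos]
    exact pow_lt_one₀ hP0.le hP1 k.succ_ne_zero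

lemma qFactorial_le_one {P : ℝ} (hP0 : 0 < P) (hP1 : P < 1) (n : ℕ) : qFactorial P n ≤ 1 :=
  Finset.prod_le_one (fun k _ ↦ by
      rw [← pow_succ', sub_nonneg]
      exact pow_le_one₀ hP0.le hP1.le)
    fun k _ ↦ sub_le_self _ (by positivity)

lemma tendsto_qFactorial {P : ℝ} (hP0 : 0 < P) (hP1 : P < 1) :
    Tendsto (qFactorial P) atTop (𝓝 (∏' k : ℕ, (1 - P * P ^ k))) :=
  (multipliable_one_sub_mul_pow P hP0.le hP1).tendsto_prod_tprod_nat

lemma tprod_one_sub_pos {P : ℝ} (hP0 : 0 < P) (hP1 : P < 1) :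
    0 < ∏' k : ℕ, (1 - P * P ^ k) :=
  tprod_one_sub_mul_pow_pos hP0.le hP1 hP0.le hP1

lemma tprod_le_qFactorial {P : ℝ} (hP0 : 0 < P) (hP1 : P < 1) (n : ℕ) :
    ∏' k : ℕ, (1 - P * P ^ k) ≤ qFactorial P n := by
  refine Antitone.le_of_tendsto (antitone_nat_of_succ_le fun n ↦ ?_) (tendsto_qFactorial hP0 hP1) n
  rw [qFactorial, Finset.prod_range_succ]
  exact mul_le_of_le_one_right (qFactorial_pos hP0 hP1 n).le (sub_le_self _ (by positivity))

/-- The reciprocal `1 / (P; P)ₙ`, extended by zero to negative integers `n`. -/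
noncomputable def invQFactorial (P : ℝ) (n : ℤ) : ℝ :=
  if n < 0 then 0 else (qFactorial P n.toNat)⁻¹

lemma invQFactorial_natCast (P : ℝ) (n : ℕ) : invQFactorial P n = (qFactorial P n)⁻¹ := by
  simp [invQFactorial]

lemma invQFactorial_sub_one {P : ℝ} (hP0 : 0 < P) (hP1 : P < 1) (n : ℤ) :
    invQFactorial P (n - 1) = (1 - P ^ n) * invQFactorial P n := by
  rcases lt_trichotomy n 0 with h | rfl | h
  · simp [invQFactorial, h, show n < 1 by lia]
  · simp [invQFactorial]
  · obtain ⟨m, rfl⟩ : ∃ m : ℕ, n = m + 1 := ⟨(n - 1).toNat, by lia⟩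
    have h1 := (qFactorial_pos hP0 hP1 m).ne'
    have h2 := (qFactorial_pos hP0 hP1 (m + 1)).ne'
    rw [add_sub_cancel_right, ← Nat.cast_succ, invQFactorial_natCast, invQFactorial_natCast,
      zpow_natCast]
    rw [Nat.succ_eq_add_one]
    field_simp
    rw [qFactorial, qFactorial, Finset.prod_range_succ]
    ring

lemma invQFactorial_nonneg {P : ℝ} (hP0 : 0 < P) (hP1 : P < 1) (n : ℤ) :
    0 ≤ invQFactorial P n := by
  unfold invQFactorial
  split_ifs
  · rfl
  · exact inv_nonneg.2 (qFactorial_pos hP0 hP1 _).le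

lemma invQFactorial_le {P : ℝ} (hP0 : 0 < P) (hP1 : P < 1) (n : ℤ) :
    invQFactorial P n ≤ (∏' k : ℕ, (1 - P * P ^ k))⁻¹ := by
  have h := tprod_one_sub_pos hP0 hP1
  unfold invQFactorial
  split_ifs
  · positivity
  · exact inv_anti₀ h (tprod_le_qFactorial hP0 hP1 _)

lemma tendsto_invQFactorial {P : ℝ} (hP0 : 0 < P) (hP1 : P < 1) :
    Tendsto (invQFactorial P) atTop (𝓝 (∏' k : ℕ, (1 - P * P ^ k))⁻¹) := by
  have h := ((tendsto_qFactorial hP0 hP1).inv₀ (tprod_one_sub_pos hP0 hP1).ne').comp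
    (tendsto_atTop_atTop.2 fun b ↦ ⟨(b : ℤ), fun a ha ↦ Int.le_toNat (by lia) |>.2 ha⟩ :
      Tendsto Int.toNat atTop atTop)
  refine h.congr' ?_
  filter_upwards [eventually_ge_atTop 0] with n hn
  simp [invQFactorial, not_lt.2 hn]

/-- The central `q`-binomial coefficient `[2N choose N + n]` to the base `P`. -/
noncomputable def centralQBinom (P : ℝ) (N : ℕ) (n : ℤ) : ℝ :=
  qFactorial P (2 * N) * invQFactorial P (N - n) * invQFactorial P (N + n)

lemma abs_centralQBinom_le {P : ℝ} (hP0 : 0 < P) (hP1 : P < 1) (N : ℕ) (n : ℤ) :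
    |centralQBinom P N n| ≤ ((∏' k : ℕ, (1 - P * P ^ k))⁻¹) ^ 2 := by
  have h := tprod_one_sub_pos hP0 hP1
  have h1 := invQFactorial_nonneg hP0 hP1 (N - n)
  have h2 := invQFactorial_nonneg hP0 hP1 (N + n)
  have h3 := (qFactorial_pos hP0 hP1 (2 * N)).le
  rw [centralQBinom, abs_of_nonneg (by positivity), sq]
  refine mul_le_mul ?_ (invQFactorial_le hP0 hP1 _) h2 (by positivity)
  exact (mul_le_of_le_one_left h1 (qFactorial_le_one hP0 hP1 _)).trans (invQFactorial_le hP0 hP1 _)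

lemma tendsto_centralQBinom {P : ℝ} (hP0 : 0 < P) (hP1 : P < 1) (n : ℤ) :
    Tendsto (centralQBinom P · n) atTop (𝓝 (∏' k : ℕ, (1 - P * P ^ k))⁻¹) := by
  have h := (tprod_one_sub_pos hP0 hP1).ne'
  have h1 := (tendsto_qFactorial hP0 hP1).comp
    (tendsto_id.const_mul_atTop' (show 0 < 2 by norm_num))
  have h2 := (tendsto_invQFactorial hP0 hP1).comp
    (tendsto_atTop_add_const_right atTop (-n) (tendsto_natCast_atTop_atTop (R := ℤ)))
  have h3 := (tendsto_invQFactorial hP0 hP1).comp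
    (tendsto_atTop_add_const_right atTop n (tendsto_natCast_atTop_atTop (R := ℤ)))
  have h4 := (h1.mul h2).mul h3
  rw [mul_inv_cancel₀ h, one_mul] at h4
  exact h4

lemma centralQBinom_succ {P : ℝ} (hP0 : 0 < P) (hP1 : P < 1) (N : ℕ) (n : ℤ) :
    centralQBinom P (N + 1) n = (1 + P ^ (2 * N + 1)) * centralQBinom P N n +
      P ^ (N + 1 - n) * centralQBinom P N (n - 1) +
      P ^ (N + 1 + n) * centralQBinom P N (n + 1) := by
  have hP := hP0.ne'
  have e1 := invQFactorial_sub_one hP0 hP1 (N + 1 - n)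
  have e2 := invQFactorial_sub_one hP0 hP1 (N + 1 + n)
  have e3 := invQFactorial_sub_one hP0 hP1 (N + 1 - n - 1)
  have e4 := invQFactorial_sub_one hP0 hP1 (N + 1 + n - 1)
  rw [e1, zpow_sub_one₀ hP] at e3
  rw [e2, zpow_sub_one₀ hP] at e4
  have huv : P ^ ((N : ℤ) + 1 - n) * P ^ ((N : ℤ) + 1 + n) = P ^ (2 * N + 2) := by
    rw [← zpow_add₀ hP, ← zpow_natCast]
    congr 1
    push_cast
    ring
  have hq : qFactorial P (2 * (N + 1)) =
      qFactorial P (2 * N) * (1 - P ^ (2 * N + 1)) * (1 - P ^ (2 * N + 2)) := by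
    rw [qFactorial, qFactorial, mul_add, mul_one, Finset.prod_range_succ, Finset.prod_range_succ]
    ring
  have hw : P ^ (2 * N + 1) = P ^ (2 * N + 2) * P⁻¹ := by
    field_simp
    ring
  simp only [centralQBinom]
  rw [hq, hw, ← huv, show (((N + 1 : ℕ) : ℤ) - n) = N + 1 - n by push_cast; ring,
    show (((N + 1 : ℕ) : ℤ) + n) = N + 1 + n by push_cast; ring,
    show ((N : ℤ) - n) = N + 1 - n - 1 by ring, show ((N : ℤ) + n) = N + 1 + n - 1 by ring,
    show ((N : ℤ) - (n - 1)) = N + 1 - n by ring,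
    show ((N : ℤ) + (n - 1)) = N + 1 + n - 1 - 1 by ring,
    show ((N : ℤ) - (n + 1)) = N + 1 - n - 1 - 1 by ring,
    show ((N : ℤ) + (n + 1)) = N + 1 + n by ring, e3, e4, e1, e2]
  ring

/-- The finite form of the Jacobi triple product identity. -/
lemma hasSum_centralQBinom {p z : ℝ} (hp0 : 0 < p) (hp1 : p < 1) (hz : 0 < z) (N : ℕ) :
    HasSum (fun n : ℤ ↦ (-1) ^ n * p ^ (n ^ 2) * z ^ n * centralQBinom (p ^ 2) N n)
      (∏ k ∈ Finset.range N, ((1 - z * p ^ (2 * k + 1)) * (1 - z⁻¹ * p ^ (2 * k + 1)))) := by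
  have hP0 : 0 < p ^ 2 := by positivity
  have hP1 : p ^ 2 < 1 := pow_lt_one₀ hp0.le hp1 two_ne_zero
  have hp := hp0.ne'
  have hz' := hz.ne'
  induction N with
  | zero =>
    convert hasSum_single (f := fun n : ℤ ↦ (-1) ^ n * p ^ (n ^ 2) * z ^ n *
      centralQBinom (p ^ 2) 0 n) 0 ?_ using 1
    · simp [centralQBinom, invQFactorial, qFactorial]
    · intro n hn
      rcases lt_or_gt_of_ne hn with h | h
      · simp [centralQBinom, invQFactorial, h]
      · simp [centralQBinom, invQFactorial, h]
  | succ N ih =>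
    have s1 := ih.mul_left (1 + p ^ (4 * N + 2))
    have s2 := ((Equiv.subRight (1 : ℤ)).hasSum_iff.2 ih).mul_left (-(z * p ^ (2 * N + 1)))
    have s3 := ((Equiv.addRight (1 : ℤ)).hasSum_iff.2 ih).mul_left (-(z⁻¹ * p ^ (2 * N + 1)))
    rw [Finset.prod_range_succ]
    refine Eq.mp (congrArg₂ (fun f a ↦ HasSum f a) (funext fun n ↦ Eq.symm ?_) (Eq.symm ?_))
      ((s1.add s2).add s3)
    · have c1 : (p ^ 2) ^ ((N : ℤ) + 1 - n) * p ^ (n ^ 2) =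
          p ^ (2 * N + 1) * p ^ ((n - 1) ^ 2) := by
        rw [← zpow_natCast, ← zpow_natCast, ← zpow_mul, ← zpow_add₀ hp, ← zpow_add₀ hp]
        congr 1
        push_cast
        ring
      have c2 : (p ^ 2) ^ ((N : ℤ) + 1 + n) * p ^ (n ^ 2) =
          p ^ (2 * N + 1) * p ^ ((n + 1) ^ 2) := by
        rw [← zpow_natCast, ← zpow_natCast, ← zpow_mul, ← zpow_add₀ hp, ← zpow_add₀ hp]
        congr 1
        push_cast
        ring
      rw [centralQBinom_succ hP0 hP1]
      simp only [Function.comp_apply, Equiv.subRight_apply, Equiv.coe_addRight]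
      have z1 : z ^ n = z * z ^ (n - 1) := by rw [zpow_sub_one₀ hz']; field_simp
      have z2 : z ^ n = z⁻¹ * z ^ (n + 1) := by rw [zpow_add_one₀ hz']; field_simp
      have n1 : (-1 : ℝ) ^ n = -(-1) ^ (n - 1) := by rw [zpow_sub_one₀ (by norm_num)]; ring
      have n2 : (-1 : ℝ) ^ n = -(-1) ^ (n + 1) := by rw [zpow_add_one₀ (by norm_num)]; ring
      set A := centralQBinom (p ^ 2) N (n - 1)
      set B := centralQBinom (p ^ 2) N (n + 1)
      have d1 : (-1) ^ n * z ^ n * A * ((p ^ 2) ^ ((N : ℤ) + 1 - n) * p ^ (n ^ 2)) =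
          -(z * p ^ (2 * N + 1)) * ((-1) ^ (n - 1) * p ^ ((n - 1) ^ 2) * z ^ (n - 1) * A) := by
        rw [c1, z1, n1]; ring
      have d2 : (-1) ^ n * z ^ n * B * ((p ^ 2) ^ ((N : ℤ) + 1 + n) * p ^ (n ^ 2)) =
          -(z⁻¹ * p ^ (2 * N + 1)) *
            ((-1) ^ (n + 1) * p ^ ((n + 1) ^ 2) * z ^ (n + 1) * B) := by
        rw [c2, z2, n2]; ring
      rw [← d1, ← d2]
      ring
    · field_simp
      ring

/-- The **Jacobi triple product identity**. -/
theorem tsum_neg_one_zpow_mul_pow_sq {p z : ℝ} (hp0 : 0 < p) (hp1 : p < 1) (hz : 0 < z) :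
    ∑' n : ℤ, (-1) ^ n * p ^ (n ^ 2) * z ^ n =
      (∏' k : ℕ, (1 - p ^ 2 * (p ^ 2) ^ k)) * (∏' k : ℕ, (1 - z * p * (p ^ 2) ^ k)) *
        ∏' k : ℕ, (1 - z⁻¹ * p * (p ^ 2) ^ k) := by
  have hP0 : 0 < p ^ 2 := by positivity
  have hP1 : p ^ 2 < 1 := pow_lt_one₀ hp0.le hp1 two_ne_zero
  set C := ∏' k : ℕ, (1 - p ^ 2 * (p ^ 2) ^ k)
  have hC : C ≠ 0 := (tprod_one_sub_pos hP0 hP1).ne'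
  have habs : ∀ n : ℤ, |(-1 : ℝ) ^ n * p ^ (n ^ 2) * z ^ n| = p ^ (n ^ 2) * z ^ n := fun n ↦ by
    rw [abs_mul, abs_mul, abs_zpow, abs_neg, abs_one, one_zpow, one_mul,
      abs_of_pos (zpow_pos hp0 _), abs_of_pos (zpow_pos hz _)]
  have h1 := tendsto_tsum_of_dominated_convergence (𝓕 := atTop)
    (f := fun (N : ℕ) (n : ℤ) ↦ (-1) ^ n * p ^ (n ^ 2) * z ^ n * centralQBinom (p ^ 2) N n)
    (g := fun n : ℤ ↦ (-1) ^ n * p ^ (n ^ 2) * z ^ n * C⁻¹)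
    ((summable_pow_sq_mul_zpow hp0 hp1 hz).mul_right (C⁻¹ ^ 2))
    (fun n ↦ (tendsto_centralQBinom hP0 hP1 n).const_mul _)
    (Eventually.of_forall fun N n ↦ by
      rw [norm_mul, Real.norm_eq_abs, habs, Real.norm_eq_abs]
      gcongr
      exact abs_centralQBinom_le hP0 hP1 N n)
  have h2 := (multipliable_one_sub_mul_pow (z * p) hP0.le hP1).tendsto_prod_tprod_nat.mul
    (multipliable_one_sub_mul_pow (z⁻¹ * p) hP0.le hP1).tendsto_prod_tprod_nat
  have h3 := tendsto_nhds_unique (h1.congr fun N ↦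
    ((hasSum_centralQBinom hp0 hp1 hz N).tsum_eq.trans ?_)) h2
  · rw [tsum_mul_right] at h3
    rw [mul_assoc, ← h3]
    field_simp
  · rw [← Finset.prod_mul_distrib]
    refine Finset.prod_congr rfl fun k _ ↦ ?_
    ring

/-- The alternating theta series `∑ (-1)ⁿ h^(a n² + b n)` over all integers `n`. -/
noncomputable def altTheta (h : ℝ) (a b : ℤ) : ℝ :=
  ∑' n : ℤ, (-1) ^ n * h ^ (a * n ^ 2 + b * n)

lemma zpow_quadratic {h : ℝ} (hh : 0 < h) (a b n : ℤ) :
    h ^ (a * n ^ 2 + b * n) = (h ^ a) ^ (n ^ 2) * (h ^ b) ^ n := by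
  rw [zpow_add₀ hh.ne', zpow_mul, zpow_mul]

lemma summable_altTheta {h : ℝ} (hh0 : 0 < h) (hh1 : h < 1) {a : ℤ} (ha : 0 < a) (b c : ℤ) :
    Summable fun n : ℤ ↦ (-1) ^ n * h ^ (a * n ^ 2 + b * n + c) := by
  have h1 := (summable_pow_sq_mul_zpow (zpow_pos hh0 a) (zpow_lt_one₀ hh0 hh1 ha)
    (zpow_pos hh0 b)).mul_right (h ^ c)
  refine Summable.of_norm (h1.congr fun n ↦ ?_)
  rw [zpow_add₀ hh0.ne', zpow_quadratic hh0, norm_mul, norm_zpow, norm_neg, norm_one, one_zpow,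
    one_mul, Real.norm_of_nonneg]
  positivity

lemma altTheta_neg (h : ℝ) (a b : ℤ) : altTheta h a (-b) = altTheta h a b := by
  rw [altTheta, altTheta, ← (Equiv.neg ℤ).tsum_eq]
  refine tsum_congr fun n ↦ ?_
  rw [Equiv.neg_apply, zpow_neg, ← inv_zpow, inv_neg, inv_one]
  congr 2
  ring

lemma altTheta_eq_tprod {h : ℝ} (hh0 : 0 < h) (hh1 : h < 1) {a : ℤ} (ha : 0 < a) (b : ℤ) :
    altTheta h a b =
      (∏' k : ℕ, (1 - (h ^ a) ^ 2 * ((h ^ a) ^ 2) ^ k)) *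
        (∏' k : ℕ, (1 - h ^ (a + b) * ((h ^ a) ^ 2) ^ k)) *
        ∏' k : ℕ, (1 - h ^ (a - b) * ((h ^ a) ^ 2) ^ k) := by
  have := tsum_neg_one_zpow_mul_pow_sq (zpow_pos hh0 a) (zpow_lt_one₀ hh0 hh1 ha)
    (zpow_pos hh0 b)
  rw [← zpow_neg, ← zpow_add₀ hh0.ne', ← zpow_add₀ hh0.ne', add_comm b a, add_comm (-b) a,
    ← sub_eq_add_neg] at this
  rw [← this]
  exact tsum_congr fun n ↦ by rw [zpow_quadratic hh0, mul_assoc]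

lemma tsum_eq_add_of_isCompl_range {α β γ : Type*} {f : α → ℝ} (hf : Summable f) {u : β → α}
    {v : γ → α} (hu : u.Injective) (hv : v.Injective)
    (huv : IsCompl (Set.range u) (Set.range v)) :
    ∑' x, f x = ∑' x, f (u x) + ∑' x, f (v x) := by
  have h1 := hu.hasSum_range_iff.2 (hf.comp_injective hu).hasSum
  have h2 := hv.hasSum_range_iff.2 (hf.comp_injective hv).hasSum
  exact (h1.add_isCompl huv h2).tsum_eq

lemma tsum_eq_add_of_parity {f : ℤ × ℤ → ℝ} (hf : Summable f) {u v : ℤ × ℤ → ℤ × ℤ}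
    (hu : u.Injective) (hv : v.Injective)
    (hru : ∀ m n, (m, n) ∈ Set.range u ↔ Even (m + n))
    (hrv : ∀ m n, (m, n) ∈ Set.range v ↔ ¬ Even (m + n)) :
    ∑' x, f x = ∑' x, f (u x) + ∑' x, f (v x) := by
  have : Set.range v = (Set.range u)ᶜ := by
    ext ⟨m, n⟩
    rw [Set.mem_compl_iff, hru, hrv]
  exact tsum_eq_add_of_isCompl_range hf hu hv (this ▸ isCompl_compl)

lemma neg_one_zpow_congr {m n : ℤ} (h : Even (m - n)) : (-1 : ℝ) ^ m = (-1) ^ n := by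
  rw [← sub_add_cancel m n, zpow_add₀ (by norm_num), h.neg_one_zpow, one_mul]

/-- A form of the quintuple product identity, as an identity between theta series. -/
lemma altTheta_quintuple {Q : ℝ} (hQ0 : 0 < Q) (hQ1 : Q < 1) (s : ℤ) :
    (altTheta Q 15 (3 * s - 1) + Q ^ (2 - s) * altTheta Q 15 (11 - 3 * s)) * altTheta Q 5 (3 + s) =
      altTheta Q 15 (-5) * altTheta Q 5 (1 + 2 * s) := by
  have prod (b c b' : ℤ) :
      (Summable fun x : ℤ × ℤ ↦
        (-1) ^ (x.1 + x.2) * Q ^ (15 * x.1 ^ 2 + b * x.1 + c + (5 * x.2 ^ 2 + b' * x.2))) ∧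
      Q ^ c * altTheta Q 15 b * altTheta Q 5 b' = ∑' x : ℤ × ℤ,
        (-1) ^ (x.1 + x.2) * Q ^ (15 * x.1 ^ 2 + b * x.1 + c + (5 * x.2 ^ 2 + b' * x.2)) := by
    have s1 := (summable_altTheta hQ0 hQ1 (a := 15) (by norm_num) b c).norm
    have s2 := (summable_altTheta hQ0 hQ1 (a := 5) (by norm_num) b' 0).norm
    have e : ∀ x : ℤ × ℤ, (-1 : ℝ) ^ x.1 * Q ^ (15 * x.1 ^ 2 + b * x.1 + c) *
        ((-1) ^ x.2 * Q ^ (5 * x.2 ^ 2 + b' * x.2 + 0)) =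
        (-1) ^ (x.1 + x.2) * Q ^ (15 * x.1 ^ 2 + b * x.1 + c + (5 * x.2 ^ 2 + b' * x.2)) := by
      intro x
      rw [zpow_add₀ (by norm_num : (-1 : ℝ) ≠ 0), zpow_add₀ hQ0.ne' _ (5 * x.2 ^ 2 + b' * x.2),
        add_zero]
      ring
    refine ⟨(summable_mul_of_summable_norm s1 s2).congr e, ?_⟩
    rw [← tsum_congr e, ← tsum_mul_tsum_of_summable_norm s1 s2, altTheta, altTheta,
      ← tsum_mul_left (a := Q ^ c)]
    congr 1
    · refine tsum_congr fun n ↦ ?_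
      rw [zpow_add₀ hQ0.ne' _ c]
      ring
    · simp only [add_zero]
  obtain ⟨s1, e1⟩ := prod (3 * s - 1) 0 (3 + s)
  obtain ⟨s2, e2⟩ := prod (11 - 3 * s) (2 - s) (3 + s)
  obtain ⟨s3, e3⟩ := prod (-5) 0 (1 + 2 * s)
  rw [zpow_zero, one_mul] at e1 e3
  rw [add_mul, e1, e2, e3]
  have t1 := tsum_eq_add_of_parity s1 (u := fun x ↦ (x.1 + x.2, x.1 - x.2))
    (v := fun x ↦ (x.2, x.2 + 2 * x.1 + 1))
    (fun x y hxy ↦ by simp only [Prod.mk.injEq] at hxy; ext <;> lia)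
    (fun x y hxy ↦ by simp only [Prod.mk.injEq] at hxy; ext <;> lia)
    (fun m n ↦ by
      simp only [Set.mem_range, Prod.exists, Prod.mk.injEq, Int.even_iff]
      exact ⟨by rintro ⟨i, j, h⟩; lia, fun h ↦ ⟨(m + n) / 2, (m - n) / 2, by lia⟩⟩)
    (fun m n ↦ by
      simp only [Set.mem_range, Prod.exists, Prod.mk.injEq, Int.even_iff]
      exact ⟨by rintro ⟨i, j, h⟩; lia, fun h ↦ ⟨(n - m) / 2, m, by lia⟩⟩)
  have t2 := tsum_eq_add_of_parity s2 (u := fun x ↦ (-(x.2 + x.1 + 1), x.2 - x.1 - 1))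
    (v := fun x ↦ (-x.1 - 1, 2 * x.2 + x.1))
    (fun x y hxy ↦ by simp only [Prod.mk.injEq] at hxy; ext <;> lia)
    (fun x y hxy ↦ by simp only [Prod.mk.injEq] at hxy; ext <;> lia)
    (fun m n ↦ by
      simp only [Set.mem_range, Prod.exists, Prod.mk.injEq, Int.even_iff]
      exact ⟨by rintro ⟨i, j, h⟩; lia,
        fun h ↦ ⟨-(m + n) / 2 - 1, (n - m) / 2, by lia⟩⟩)
    (fun m n ↦ by
      simp only [Set.mem_range, Prod.exists, Prod.mk.injEq, Int.even_iff]
      exact ⟨by rintro ⟨i, j, h⟩; lia, fun h ↦ ⟨-m - 1, (m + n + 1) / 2, by lia⟩⟩)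
  have t3 := tsum_eq_add_of_parity s3 (u := fun x ↦ (x.2, x.2 + 2 * x.1))
    (v := fun x ↦ (x.2, x.2 + 2 * x.1 + 1))
    (fun x y hxy ↦ by simp only [Prod.mk.injEq] at hxy; ext <;> lia)
    (fun x y hxy ↦ by simp only [Prod.mk.injEq] at hxy; ext <;> lia)
    (fun m n ↦ by
      simp only [Set.mem_range, Prod.exists, Prod.mk.injEq, Int.even_iff]
      exact ⟨by rintro ⟨i, j, h⟩; lia, fun h ↦ ⟨(n - m) / 2, m, by lia⟩⟩)
    (fun m n ↦ by
      simp only [Set.mem_range, Prod.exists, Prod.mk.injEq, Int.even_iff]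
      exact ⟨by rintro ⟨i, j, h⟩; lia, fun h ↦ ⟨(n - m) / 2, m, by lia⟩⟩)
  rw [t1, t2, t3]
  have cancel : ∀ A A' B B' C D : ℝ, A = A' → B = B' → C = -D →
      A + C + (D + B) = A' + B' := by
    intros; linarith
  refine cancel _ _ _ _ _ _ (tsum_congr fun x ↦ ?_) (tsum_congr fun x ↦ ?_) ?_
  · congr 1
    · exact neg_one_zpow_congr ⟨-x.2, by ring⟩
    · congr 1
      ring
  · congr 1
    · exact neg_one_zpow_congr ⟨-x.1 - 1, by ring⟩
    · congr 1
      ring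
  · rw [← tsum_neg]
    refine tsum_congr fun x ↦ ?_
    rw [← neg_mul, ← neg_one_mul ((-1) ^ _), ← zpow_one_add₀ (by norm_num)]
    congr 1
    · exact neg_one_zpow_congr ⟨x.2 + 2 * x.1 + 1, by ring⟩
    · congr 1
      ring

lemma tprod_eq_of_tendsto {f : ℕ → ℝ} (hf : Multipliable f) {l : ℝ} {d : ℕ} (hd : 0 < d)
    (h : Tendsto (fun N ↦ ∏ m ∈ Finset.range N, ∏ r ∈ Finset.range d, f (d * m + r)) atTop (𝓝 l)) :
    ∏' n, f n = l := by
  refine tendsto_nhds_unique ?_ h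
  refine (hf.tendsto_prod_tprod_nat.comp (tendsto_id.const_mul_atTop' hd)).congr fun N ↦ ?_
  simp only [Function.comp_apply, id]
  induction N with
  | zero => simp
  | succ N ih => rw [mul_add, mul_one, Finset.prod_range_add, ih, Finset.prod_range_succ]

/-- Euler's **pentagonal number theorem**. -/
lemma altTheta_three_neg_one {h : ℝ} (hh0 : 0 < h) (hh1 : h < 1) :
    altTheta h 3 (-1) = ∏' n : ℕ, (1 - (h ^ 2) ^ (n + 1)) := by
  have h6 : (h ^ 3) ^ 2 < 1 := pow_lt_one₀ (by positivity)
    (pow_lt_one₀ hh0.le hh1 (by norm_num)) (by norm_num)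
  have m (c : ℝ) := (multipliable_one_sub_mul_pow c (sq_nonneg (h ^ 3))
    h6).tendsto_prod_tprod_nat
  have hm : Multipliable fun n : ℕ ↦ 1 - (h ^ 2) ^ (n + 1) := by
    refine (multipliable_one_sub_mul_pow (h ^ 2) (sq_nonneg h)
      (pow_lt_one₀ hh0.le hh1 two_ne_zero)).congr fun n ↦ ?_
    rw [pow_succ' (h ^ 2)]
  rw [altTheta_eq_tprod hh0 hh1 (by norm_num), show (3 : ℤ) + -1 = 2 by norm_num,
    show (3 : ℤ) - -1 = 4 by norm_num,
    zpow_ofNat h 3, zpow_ofNat h 2, zpow_ofNat h 4]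
  refine (tprod_eq_of_tendsto hm (d := 3) (by norm_num) ?_).symm
  refine (((m _).mul (m _)).mul (m _)).congr fun N ↦ ?_
  rw [← Finset.prod_mul_distrib, ← Finset.prod_mul_distrib]
  refine Finset.prod_congr rfl fun k _ ↦ ?_
  simp only [Finset.prod_range_succ, Finset.prod_range_zero, one_mul]
  ring

lemma altTheta_rescale {h : ℝ} (k : ℕ) (a b : ℤ) :
    altTheta h (k * a) (k * b) = altTheta (h ^ k) a b := by
  refine tsum_congr fun n ↦ ?_
  rw [← zpow_natCast h k, ← zpow_mul]
  congr 2
  ring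

/-- The 5-dissection of Euler's product. -/
lemma altTheta_three_neg_one_dissection {h : ℝ} (hh0 : 0 < h) (hh1 : h < 1) :
    altTheta h 3 (-1) =
      (altTheta (h ^ 5) 15 (-1) + (h ^ 5) ^ 2 * altTheta (h ^ 5) 15 11) -
        h ^ 2 * altTheta (h ^ 5) 15 (-5) -
        h ^ 4 * (altTheta (h ^ 5) 15 (-7) + (h ^ 5) ^ 4 * altTheta (h ^ 5) 15 17) := by
  have hh := hh0.ne'
  have hs := summable_altTheta hh0 hh1 (a := 3) (by norm_num) (-1) 0
  simp only [add_zero] at hs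
  have hs' := (Equiv.prodComm (Fin 5) ℤ).summable_iff.2 ((Int.divModEquiv 5).symm.summable_iff.2 hs)
  have residue (c b e : ℤ)
      (he : ∀ m, 3 * (5 * m + c) ^ 2 + -1 * (5 * m + c) = 5 * (15 * m ^ 2 + b * m) + e) :
      ∑' m : ℤ, (-1 : ℝ) ^ (m * 5 + c) * h ^ (3 * (m * 5 + c) ^ 2 + -1 * (m * 5 + c)) =
        (-1) ^ c * h ^ e * altTheta (h ^ 5) 15 b := by
    rw [altTheta, ← tsum_mul_left]
    refine tsum_congr fun m ↦ ?_
    rw [mul_comm m 5, he, zpow_add₀ hh, zpow_add₀ (by norm_num), zpow_mul h, zpow_ofNat h,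
      neg_one_zpow_congr (m := 5 * m) (n := m) ⟨2 * m, by ring⟩]
    ring
  have r0 := residue 0 (-1) 0 (fun m ↦ by ring)
  have r1 := residue 1 (-(-5)) 2 (fun m ↦ by ring)
  have r2 := residue 2 11 10 (fun m ↦ by ring)
  have r3 := residue 3 17 24 (fun m ↦ by ring)
  have r4 : ∑' m : ℤ, (-1 : ℝ) ^ (m * 5 + 4) * h ^ (3 * (m * 5 + 4) ^ 2 + -1 * (m * 5 + 4)) =
      (-1) ^ (-1 : ℤ) * h ^ (4 : ℤ) * altTheta (h ^ 5) 15 (-7) := by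
    rw [← residue (-1) (-7) 4 (fun m ↦ by ring), ← (Equiv.subRight (1 : ℤ)).tsum_eq]
    refine tsum_congr fun m ↦ ?_
    rw [Equiv.subRight_apply, show (m - 1) * 5 + 4 = m * 5 + -1 by ring]
  rw [altTheta_neg] at r1
  rw [altTheta, ← (Int.divModEquiv 5).symm.tsum_eq, ← (Equiv.prodComm (Fin 5) ℤ).tsum_eq]
  refine hs'.tsum_prod.trans ?_
  rw [tsum_fintype, Fin.sum_univ_five]
  refine (congrArg₂ (· + ·) (congrArg₂ (· + ·) (congrArg₂ (· + ·) (congrArg₂ (· + ·) r0 r1) r2) r3)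
    r4).trans ?_
  norm_num
  norm_cast
  ring

lemma altTheta_pos {h : ℝ} (hh0 : 0 < h) (hh1 : h < 1) {a b : ℤ} (hb : |b| < a) :
    0 < altTheta h a b := by
  have hb' := abs_lt.1 hb
  have ha : 0 < a := (abs_nonneg b).trans_lt hb
  have h1 := zpow_pos hh0 a
  have h2 : (h ^ a) ^ 2 < 1 := pow_lt_one₀ h1.le (zpow_lt_one₀ hh0 hh1 ha) two_ne_zero
  have pos (c : ℤ) (hc : 0 < c) : 0 < ∏' k : ℕ, (1 - h ^ c * ((h ^ a) ^ 2) ^ k) :=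
    tprod_one_sub_mul_pow_pos (zpow_pos hh0 c).le (zpow_lt_one₀ hh0 hh1 hc) (sq_nonneg _) h2
  rw [altTheta_eq_tprod hh0 hh1 ha]
  exact mul_pos (mul_pos (tprod_one_sub_pos (by positivity) h2) (pos _ (by lia))) (pos _ (by lia))

lemma multipliable_chi5 {q : ℝ} (hq0 : 0 < q) (hq1 : q < 1) :
    Multipliable fun n : ℕ ↦ (1 - q ^ (n + 1)) ^ chi5 (n + 1) := by
  have hs : Summable fun n : ℕ ↦ q ^ (n + 1) / (1 - q) := by
    simp_rw [pow_succ]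
    exact ((summable_geometric_of_lt_one hq0.le hq1).mul_right q).div_const _
  have h1 : 0 < 1 - q := sub_pos.2 hq1
  have hm : Summable fun n : ℕ ↦ (1 - q ^ (n + 1)) ^ chi5 (n + 1) - 1 := by
    refine Summable.of_norm_bounded hs fun n ↦ ?_
    have h2 : 0 < q ^ (n + 1) := by positivity
    have h3 : q ^ (n + 1) ≤ q := pow_le_of_le_one hq0.le hq1.le n.succ_ne_zero
    have h4 : 0 < 1 - q ^ (n + 1) := by linarith
    have h5 : q ^ (n + 1) ≤ q ^ (n + 1) / (1 - q) := le_div_self h2.le h1 (by linarith)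
    unfold chi5
    split_ifs
    · simpa [abs_of_pos hq0] using h5
    · rw [zpow_neg_one, show (1 - q ^ (n + 1))⁻¹ - 1 = q ^ (n + 1) / (1 - q ^ (n + 1)) by
        field_simp; ring, Real.norm_of_nonneg (by positivity)]
      gcongr
    · simp only [zpow_zero, sub_self, norm_zero]
      positivity
  simpa using Real.multipliable_one_add_of_summable hm

lemma tprod_chi5 {q : ℝ} (hq0 : 0 < q) (hq1 : q < 1) :
    ∏' n : ℕ, (1 - q ^ (n + 1)) ^ chi5 (n + 1) =
      ((∏' k : ℕ, (1 - q ^ 4 * (q ^ 5) ^ k)) * ∏' k : ℕ, (1 - q * (q ^ 5) ^ k)) /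
        ((∏' k : ℕ, (1 - q ^ 3 * (q ^ 5) ^ k)) * ∏' k : ℕ, (1 - q ^ 2 * (q ^ 5) ^ k)) := by
  have h5 : q ^ 5 < 1 := pow_lt_one₀ hq0.le hq1 (by norm_num)
  have m (c : ℝ) := (multipliable_one_sub_mul_pow c (by positivity) h5).tendsto_prod_tprod_nat
  have pos (c : ℕ) (hc : c ≠ 0) : 0 < ∏' k : ℕ, (1 - q ^ c * (q ^ 5) ^ k) :=
    tprod_one_sub_mul_pow_pos (by positivity) (pow_lt_one₀ hq0.le hq1 hc) (by positivity) h5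
  refine tprod_eq_of_tendsto (multipliable_chi5 hq0 hq1) (d := 5) (by norm_num) ?_
  refine (((m _).mul (m _)).div ((m _).mul (m _))
    (mul_pos (pos 3 (by norm_num)) (pos 2 (by norm_num))).ne').congr fun N ↦ ?_
  rw [Pi.div_apply, ← Finset.prod_mul_distrib, ← Finset.prod_mul_distrib,
    ← Finset.prod_div_distrib]
  refine Finset.prod_congr rfl fun k _ ↦ ?_
  have c0 : chi5 (5 * k + 0 + 1) = 1 := by simp [chi5, show (5 * k + 0 + 1) % 5 = 1 by lia]
  have c1 : chi5 (5 * k + 1 + 1) = -1 := by simp [chi5, show (5 * k + 1 + 1) % 5 = 2 by lia]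
  have c2 : chi5 (5 * k + 2 + 1) = -1 := by simp [chi5, show (5 * k + 2 + 1) % 5 = 3 by lia]
  have c3 : chi5 (5 * k + 3 + 1) = 1 := by simp [chi5, show (5 * k + 3 + 1) % 5 = 4 by lia]
  have c4 : chi5 (5 * k + 4 + 1) = 0 := by simp [chi5, show (5 * k + 4 + 1) % 5 = 0 by lia]
  simp only [Finset.prod_range_succ, Finset.prod_range_zero, one_mul, c0, c1, c2, c3, c4, zpow_one,
    zpow_neg, zpow_zero, mul_one, div_eq_mul_inv, mul_inv]
  ring

/-- The Rogers–Ramanujan continued fraction as a quotient of theta series. -/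
lemma RR_eq_altTheta_div {h : ℝ} (hh0 : 0 < h) (hh1 : h < 1) :
    RR (h ^ 10) = h ^ 2 * (altTheta (h ^ 5) 5 3 / altTheta (h ^ 5) 5 1) := by
  have hQ0 : 0 < h ^ 5 := by positivity
  have hQ1 : h ^ 5 < 1 := pow_lt_one₀ hh0.le hh1 (by norm_num)
  have hP0 : 0 < ((h ^ 5) ^ (5 : ℤ)) ^ 2 := by positivity
  have hP1 : ((h ^ 5) ^ (5 : ℤ)) ^ 2 < 1 :=
    pow_lt_one₀ (by positivity) (zpow_lt_one₀ hQ0 hQ1 (by norm_num)) two_ne_zero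
  rw [RR, tprod_chi5 (by positivity) (pow_lt_one₀ hh0.le hh1 (by norm_num)),
    altTheta_eq_tprod hQ0 hQ1 (by norm_num), altTheta_eq_tprod hQ0 hQ1 (by norm_num), mul_assoc,
    mul_assoc, mul_div_mul_left _ _ (tprod_one_sub_pos hP0 hP1).ne']
  congr 1
  · rw [← Real.rpow_natCast, ← Real.rpow_natCast, ← Real.rpow_mul hh0.le]
    norm_num
  · have e : ((h ^ 5) ^ (5 : ℤ)) ^ 2 = (h ^ 10) ^ 5 := by norm_cast; ring
    have e8 : (h ^ 5) ^ ((5 : ℤ) + 3) = (h ^ 10) ^ 4 := by norm_num; ring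
    have e2 : (h ^ 5) ^ ((5 : ℤ) - 3) = h ^ 10 := by norm_num; ring
    have e6 : (h ^ 5) ^ ((5 : ℤ) + 1) = (h ^ 10) ^ 3 := by norm_num; ring
    have e4 : (h ^ 5) ^ ((5 : ℤ) - 1) = (h ^ 10) ^ 2 := by norm_num; ring
    rw [e, e8, e2, e6, e4]

theorem RR_eq_root_of_quadratic (q x : ℝ) (hq0 : 0 < q) (hq1 : q < 1)
    (hx : x = (∏' n : ℕ, (1 - q ^ (((n : ℝ) + 1) / 5))) /
      (q ^ ((1 : ℝ) / 5) * ∏' n : ℕ, (1 - (q ^ 5) ^ (n + 1)))) :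
    RR q = (Real.sqrt (x ^ 2 + 2 * x + 5) - x - 1) / 2 := by
  obtain ⟨h, hh0, hh1, rfl⟩ : ∃ h : ℝ, 0 < h ∧ h < 1 ∧ q = h ^ 10 := by
    refine ⟨q ^ ((1 : ℝ) / 10), by positivity, Real.rpow_lt_one hq0.le hq1 (by norm_num), ?_⟩
    rw [← Real.rpow_natCast, ← Real.rpow_mul hq0.le]
    norm_num
  have hQ0 : 0 < h ^ 5 := by positivity
  have hQ1 : h ^ 5 < 1 := pow_lt_one₀ hh0.le hh1 (by norm_num)
  have hpow (y : ℝ) : (h ^ 10) ^ (y / 5) = (h ^ 2) ^ y := by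
    rw [← Real.rpow_natCast, ← Real.rpow_natCast, ← Real.rpow_mul hh0.le, ← Real.rpow_mul hh0.le]
    congr 1
    push_cast
    ring
  have hE : ∏' n : ℕ, (1 - ((h ^ 10) ^ 5) ^ (n + 1)) = altTheta (h ^ 5) 15 (-5) := by
    have := altTheta_three_neg_one (pow_pos hQ0 5) (pow_lt_one₀ hQ0.le hQ1 (by norm_num))
    rw [← altTheta_rescale] at this
    norm_num at this
    rw [this]
    refine tprod_congr fun n ↦ ?_
    ring
  have hnum : ∏' n : ℕ, (1 - (h ^ 10) ^ (((n : ℝ) + 1) / 5)) = altTheta h 3 (-1) := by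
    rw [altTheta_three_neg_one hh0 hh1]
    refine tprod_congr fun n ↦ ?_
    rw [hpow]
    norm_cast
  rw [hnum, hpow, Real.rpow_one, hE, altTheta_three_neg_one_dissection hh0 hh1] at hx
  have hA : (altTheta (h ^ 5) 15 (-1) + (h ^ 5) ^ 2 * altTheta (h ^ 5) 15 11) *
      altTheta (h ^ 5) 5 3 = altTheta (h ^ 5) 15 (-5) * altTheta (h ^ 5) 5 1 := by
    rw [← zpow_ofNat (h ^ 5) 2]
    exact altTheta_quintuple hQ0 hQ1 0
  have hB : (altTheta (h ^ 5) 15 (-7) + (h ^ 5) ^ 4 * altTheta (h ^ 5) 15 17) *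
      altTheta (h ^ 5) 5 1 = altTheta (h ^ 5) 15 (-5) * altTheta (h ^ 5) 5 3 := by
    rw [← altTheta_neg _ 5 3, ← zpow_ofNat (h ^ 5) 4]
    exact altTheta_quintuple hQ0 hQ1 (-2)
  have p3 : 0 < altTheta (h ^ 5) 5 3 := altTheta_pos hQ0 hQ1 (by norm_num)
  have p1 : 0 < altTheta (h ^ 5) 5 1 := altTheta_pos hQ0 hQ1 (by norm_num)
  have pE : 0 < altTheta (h ^ 5) 15 (-5) := altTheta_pos hQ0 hQ1 (by norm_num)
  rw [RR_eq_altTheta_div hh0 hh1]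
  rw [← eq_div_iff p3.ne'] at hA
  rw [← eq_div_iff p1.ne'] at hB
  rw [hA, hB] at hx
  set R := h ^ 2 * (altTheta (h ^ 5) 5 3 / altTheta (h ^ 5) 5 1) with hR
  have hR0 : 0 < R := by positivity
  have hxR : x = 1 / R - 1 - R := by
    rw [hx, hR]
    field_simp
  have hsq : x ^ 2 + 2 * x + 5 = (1 / R + R) ^ 2 := by
    rw [hxR]
    field_simp
    ring
  rw [hsq, Real.sqrt_sq (by positivity), hxR]
  ring
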